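/- (Uniqueness of Control Claim) Let TrackStatus : Tracks × [0,∞) → {empty, coming, incrossing} satisfy the train motion and piecewise-constancy requirements. Suppose (Deadline, Dir) and (Deadline′, Dir′) are two pairs of functions, Deadline, Deadline′ : Tracks × [0,∞) → ℝ ∪ {∞} and Dir, Dir′ : [0,∞) → {open, close}, each satisfying, together with the given TrackStatus, the piecewise constancy, left-continuity, initial state, and immediate controller conditions. Then Deadline(x,t) = Deadline′(x,t) for every track x and every t ≥ 0, and Dir(t) = Dir′(t) for every t ≥ 0. -/

import Mathlib

namespace RailCross

inductive TStat : Type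
  | emp | coming | incrossing
deriving DecidableEq

inductive DirV : Type
  | opn | cls
deriving DecidableEq

inductive GateV : Type
  | opened | closed
deriving DecidableEq

/-- `f` is piecewise constant on `[0, ∞)`: for every `τ > 0` there is a finite
partition `0 = s 0 < s 1 < … < s n = τ` such that `f` is constant on each open
subinterval `(s i, s (i+1))`. -/
def PWC {Y : Type*} (f : ℝ → Y) : Prop :=
  ∀ τ : ℝ, 0 < τ → ∃ n : ℕ, ∃ s : ℕ → ℝ,
    s 0 = 0 ∧ s n = τ ∧ (∀ i < n, s i < s (i + 1)) ∧
    (∀ i < n, ∀ a b : ℝ, s i < a → a < b → b < s (i + 1) → f a = f b)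

/-- `v` is the right-hand value `f(t+)`: `f` is constantly `v` on some `(t, t+ε)`. -/
def RightVal {Y : Type*} (f : ℝ → Y) (t : ℝ) (v : Y) : Prop :=
  ∃ ε : ℝ, 0 < ε ∧ ∀ u : ℝ, t < u → u < t + ε → f u = v

/-- `v` is the left-hand value `f(t−)` (for `t > 0`): `f` is constantly `v` on some `(t-ε, t)`. -/
def LeftVal {Y : Type*} (f : ℝ → Y) (t : ℝ) (v : Y) : Prop :=
  ∃ ε : ℝ, 0 < ε ∧ ε ≤ t ∧ ∀ u : ℝ, t - ε < u → u < t → f u = v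

/-- `tm` is the (finite or infinite) increasing sequence of significant moments of a
track with status function `f`; a finite sequence is encoded by letting `tm` take the
value `⊤ = ∞` from some point on. -/
structure TrainMotion (dmin dmax : ℝ) (f : ℝ → TStat) (tm : ℕ → EReal) : Prop where
  zero : tm 0 = 0
  mono : Monotone tm
  strict : ∀ i, tm i ≠ ⊤ → tm i < tm (i + 1)
  last_div : ∀ k, tm k ≠ ⊤ → tm (k + 1) = ⊤ → 3 ∣ k
  status_empty : ∀ i : ℕ, ∀ u : ℝ, tm (3 * i) ≤ (u : EReal) → (u : EReal) < tm (3 * i + 1) →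
    f u = TStat.emp
  status_coming : ∀ i : ℕ, ∀ u : ℝ, tm (3 * i + 1) ≤ (u : EReal) → (u : EReal) < tm (3 * i + 2) →
    f u = TStat.coming
  status_cross : ∀ i : ℕ, ∀ u : ℝ, tm (3 * i + 2) ≤ (u : EReal) → (u : EReal) < tm (3 * i + 3) →
    f u = TStat.incrossing
  gap : ∀ i : ℕ, ∀ a b : ℝ, tm (3 * i + 1) = (a : EReal) → tm (3 * i + 2) = (b : EReal) →
    dmin ≤ b - a ∧ b - a ≤ dmax

/-- `SafeToOpen(t)`: every track is empty or its deadline is more than `dopen` away. -/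
def SafeToOpen {Tracks : Type*} (dopen : ℝ) (trackStatus : Tracks → ℝ → TStat)
    (deadline : Tracks → ℝ → EReal) (t : ℝ) : Prop :=
  ∀ x : Tracks, trackStatus x t = TStat.emp ∨ ((t + dopen : ℝ) : EReal) < deadline x t

/-- A regular run of the railroad-crossing evolving algebra.  `WaitTime = dmin - dclose`. -/
structure RegularRun (Tracks : Type*) (dmin dmax dopen dclose : ℝ) where
  trackStatus : Tracks → ℝ → TStat
  deadline : Tracks → ℝ → EReal
  dir : ℝ → DirV
  gate : ℝ → GateV
  /-- the right-hand value `Deadline(x, t+)` -/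
  deadlinePlus : Tracks → ℝ → EReal
  /-- the right-hand value `Dir(t+)` -/
  dirPlus : ℝ → DirV
  /-- the right-hand value `GateStatus(t+)` -/
  gatePlus : ℝ → GateV
  pwc_ts : ∀ x, PWC (trackStatus x)
  pwc_dl : ∀ x, PWC (deadline x)
  pwc_dir : PWC dir
  pwc_gate : PWC gate
  dlPlus_spec : ∀ x, ∀ t : ℝ, 0 ≤ t → RightVal (deadline x) t (deadlinePlus x t)
  dirPlus_spec : ∀ t : ℝ, 0 ≤ t → RightVal dir t (dirPlus t)
  gatePlus_spec : ∀ t : ℝ, 0 ≤ t → RightVal gate t (gatePlus t)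
  dl_left : ∀ x, ∀ t : ℝ, 0 < t → LeftVal (deadline x) t (deadline x t)
  dir_left : ∀ t : ℝ, 0 < t → LeftVal dir t (dir t)
  gate_left : ∀ t : ℝ, 0 < t → LeftVal gate t (gate t)
  trainMotion : ∀ x, ∃ tm : ℕ → EReal, TrainMotion dmin dmax (trackStatus x) tm
  dl_init : ∀ x, deadline x 0 = ⊤
  dir_init : dir 0 = DirV.opn
  gate_init : gate 0 = GateV.opened
  dl_step_coming : ∀ x, ∀ t : ℝ, 0 ≤ t → trackStatus x t = TStat.coming → deadline x t = ⊤ →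
    deadlinePlus x t = ((t + (dmin - dclose) : ℝ) : EReal)
  dl_step_empty : ∀ x, ∀ t : ℝ, 0 ≤ t → trackStatus x t = TStat.emp → deadline x t ≠ ⊤ →
    deadlinePlus x t = ⊤
  dl_step_other : ∀ x, ∀ t : ℝ, 0 ≤ t →
    ¬(trackStatus x t = TStat.coming ∧ deadline x t = ⊤) →
    ¬(trackStatus x t = TStat.emp ∧ deadline x t ≠ ⊤) →
    deadlinePlus x t = deadline x t
  dir_step_close : ∀ t : ℝ, 0 ≤ t → (∃ x, deadline x t = (t : EReal)) → dirPlus t = DirV.cls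
  dir_step_open : ∀ t : ℝ, 0 ≤ t → (∀ x, deadline x t ≠ (t : EReal)) → dir t = DirV.cls →
    SafeToOpen dopen trackStatus deadline t → dirPlus t = DirV.opn
  dir_step_other : ∀ t : ℝ, 0 ≤ t → (∀ x, deadline x t ≠ (t : EReal)) →
    ¬(dir t = DirV.cls ∧ SafeToOpen dopen trackStatus deadline t) → dirPlus t = dir t
  gate_step : ∀ t : ℝ, 0 ≤ t →
    gatePlus t = gate t ∨ (dir t = DirV.opn ∧ gatePlus t = GateV.opened) ∨
      (dir t = DirV.cls ∧ gatePlus t = GateV.closed)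
  gate_close_bound : ∀ t : ℝ, 0 ≤ t →
    ¬(∀ u ∈ Set.Ioo t (t + dclose), dir u = DirV.cls ∧ gate u = GateV.opened)
  gate_open_bound : ∀ t : ℝ, 0 ≤ t →
    ¬(∀ u ∈ Set.Ioo t (t + dopen), dir u = DirV.opn ∧ gate u = GateV.closed)


/-- The controller part of a run (no gate): used for the Uniqueness of Control Claim. -/
structure ControlRun (Tracks : Type*) (dmin dmax dopen dclose : ℝ) where
  trackStatus : Tracks → ℝ → TStat
  deadline : Tracks → ℝ → EReal
  dir : ℝ → DirV
  deadlinePlus : Tracks → ℝ → EReal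
  dirPlus : ℝ → DirV
  pwc_ts : ∀ x, PWC (trackStatus x)
  pwc_dl : ∀ x, PWC (deadline x)
  pwc_dir : PWC dir
  dlPlus_spec : ∀ x, ∀ t : ℝ, 0 ≤ t → RightVal (deadline x) t (deadlinePlus x t)
  dirPlus_spec : ∀ t : ℝ, 0 ≤ t → RightVal dir t (dirPlus t)
  dl_left : ∀ x, ∀ t : ℝ, 0 < t → LeftVal (deadline x) t (deadline x t)
  dir_left : ∀ t : ℝ, 0 < t → LeftVal dir t (dir t)
  trainMotion : ∀ x, ∃ tm : ℕ → EReal, TrainMotion dmin dmax (trackStatus x) tm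
  dl_init : ∀ x, deadline x 0 = ⊤
  dir_init : dir 0 = DirV.opn
  dl_step_coming : ∀ x, ∀ t : ℝ, 0 ≤ t → trackStatus x t = TStat.coming → deadline x t = ⊤ →
    deadlinePlus x t = ((t + (dmin - dclose) : ℝ) : EReal)
  dl_step_empty : ∀ x, ∀ t : ℝ, 0 ≤ t → trackStatus x t = TStat.emp → deadline x t ≠ ⊤ →
    deadlinePlus x t = ⊤
  dl_step_other : ∀ x, ∀ t : ℝ, 0 ≤ t →
    ¬(trackStatus x t = TStat.coming ∧ deadline x t = ⊤) →
    ¬(trackStatus x t = TStat.emp ∧ deadline x t ≠ ⊤) →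
    deadlinePlus x t = deadline x t
  dir_step_close : ∀ t : ℝ, 0 ≤ t → (∃ x, deadline x t = (t : EReal)) → dirPlus t = DirV.cls
  dir_step_open : ∀ t : ℝ, 0 ≤ t → (∀ x, deadline x t ≠ (t : EReal)) → dir t = DirV.cls →
    SafeToOpen dopen trackStatus deadline t → dirPlus t = DirV.opn
  dir_step_other : ∀ t : ℝ, 0 ≤ t → (∀ x, deadline x t ≠ (t : EReal)) →
    ¬(dir t = DirV.cls ∧ SafeToOpen dopen trackStatus deadline t) → dirPlus t = dir t

/-- Two left-continuous functions on `[0, ∞)` that start equal, and whose right-hand values agree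
wherever the functions do, are equal. -/
theorem eq_of_leftVal_of_rightVal {Y : Type*} {f g : ℝ → Y} (h0 : f 0 = g 0)
    (hf : ∀ t : ℝ, 0 < t → LeftVal f t (f t)) (hg : ∀ t : ℝ, 0 < t → LeftVal g t (g t))
    (hR : ∀ t : ℝ, 0 ≤ t → f t = g t → ∃ v, RightVal f t v ∧ RightVal g t v)
    (t : ℝ) (ht : 0 ≤ t) : f t = g t := by
  by_contra hne
  let S : Set ℝ := {u | 0 ≤ u ∧ f u ≠ g u}
  have hS : S.Nonempty := ⟨t, ht, hne⟩
  have hbdd : BddBelow S := ⟨0, fun u hu => hu.1⟩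
  have hT0 : 0 ≤ sInf S := le_csInf hS fun u hu => hu.1
  have hbelow : ∀ u, 0 ≤ u → u < sInf S → f u = g u := fun u hu hlt => by
    by_contra h
    exact absurd (csInf_le hbdd (show u ∈ S from ⟨hu, h⟩)) (not_le.mpr hlt)
  have hT : f (sInf S) = g (sInf S) := by
    rcases hT0.eq_or_lt with h | h
    · rw [← h, h0]
    · obtain ⟨ε, hε, hεT, hfε⟩ := hf _ h
      obtain ⟨δ, hδ, hδT, hgδ⟩ := hg _ h
      obtain ⟨u, hu, huT⟩ := exists_between
        (max_lt (sub_lt_self (sInf S) hε) (sub_lt_self (sInf S) hδ))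
      obtain ⟨hu₁, hu₂⟩ := max_lt_iff.mp hu
      rw [← hfε u hu₁ huT, ← hgδ u hu₂ huT]
      exact hbelow u (by linarith) huT
  obtain ⟨v, ⟨ε, hε, hfε⟩, ⟨δ, hδ, hgδ⟩⟩ := hR _ hT0 hT
  obtain ⟨u, huS, hu⟩ := exists_lt_of_csInf_lt hS
    (lt_min (lt_add_of_pos_right (sInf S) hε) (lt_add_of_pos_right (sInf S) hδ))
  obtain ⟨hu₁, hu₂⟩ := lt_min_iff.mp hu
  have hlt : sInf S < u := lt_of_le_of_ne (csInf_le hbdd huS) fun h => huS.2 (h ▸ hT)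
  exact huS.2 ((hfε u hlt hu₁).trans (hgδ u hlt hu₂).symm)

namespace ControlRun

variable {Tracks : Type*} {dmin dmax dopen dclose : ℝ}
  {C C' : ControlRun Tracks dmin dmax dopen dclose}

theorem deadlinePlus_congr {x : Tracks} {t : ℝ} (ht : 0 ≤ t)
    (hts : C.trackStatus x t = C'.trackStatus x t) (hdl : C.deadline x t = C'.deadline x t) :
    C.deadlinePlus x t = C'.deadlinePlus x t := by
  by_cases h₁ : C.trackStatus x t = TStat.coming ∧ C.deadline x t = ⊤
  · rw [C.dl_step_coming x t ht h₁.1 h₁.2,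
      C'.dl_step_coming x t ht (hts ▸ h₁.1) (hdl ▸ h₁.2)]
  · by_cases h₂ : C.trackStatus x t = TStat.emp ∧ C.deadline x t ≠ ⊤
    · rw [C.dl_step_empty x t ht h₂.1 h₂.2,
        C'.dl_step_empty x t ht (hts ▸ h₂.1) (hdl ▸ h₂.2)]
    · rw [C.dl_step_other x t ht h₁ h₂, hdl,
        C'.dl_step_other x t ht (hts ▸ hdl ▸ h₁) (hts ▸ hdl ▸ h₂)]

theorem safeToOpen_congr {t : ℝ} (hts : ∀ x, C.trackStatus x t = C'.trackStatus x t)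
    (hdl : ∀ x, C.deadline x t = C'.deadline x t) :
    SafeToOpen dopen C.trackStatus C.deadline t ↔
      SafeToOpen dopen C'.trackStatus C'.deadline t := by
  simp only [SafeToOpen, hts, hdl]

theorem dirPlus_congr {t : ℝ} (ht : 0 ≤ t) (hts : ∀ x, C.trackStatus x t = C'.trackStatus x t)
    (hdl : ∀ x, C.deadline x t = C'.deadline x t) (hdir : C.dir t = C'.dir t) :
    C.dirPlus t = C'.dirPlus t := by
  have hsafe := safeToOpen_congr hts hdl
  by_cases h₁ : ∃ x, C.deadline x t = (t : EReal)
  · have h₁' : ∃ x, C'.deadline x t = (t : EReal) := by simpa only [hdl] using h₁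
    rw [C.dir_step_close t ht h₁, C'.dir_step_close t ht h₁']
  · have h₁ : ∀ x, C.deadline x t ≠ (t : EReal) := not_exists.mp h₁
    have h₁' : ∀ x, C'.deadline x t ≠ (t : EReal) := fun x => hdl x ▸ h₁ x
    by_cases h₂ : C.dir t = DirV.cls ∧ SafeToOpen dopen C.trackStatus C.deadline t
    · rw [C.dir_step_open t ht h₁ h₂.1 h₂.2,
        C'.dir_step_open t ht h₁' (hdir ▸ h₂.1) (hsafe.mp h₂.2)]
    · have h₂' : ¬(C'.dir t = DirV.cls ∧ SafeToOpen dopen C'.trackStatus C'.deadline t) := by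
        rwa [← hdir, ← hsafe]
      rw [C.dir_step_other t ht h₁ h₂, C'.dir_step_other t ht h₁' h₂', hdir]

end ControlRun

theorem uniqueness_of_control {Tracks : Type*} [Fintype Tracks] [Nonempty Tracks]
    {dmin dmax dopen dclose : ℝ}
    (hdmin : 0 < dmin) (hdmax : 0 < dmax) (hdopen : 0 < dopen) (hdclose : 0 < dclose)
    (hcm : dclose < dmin) (hmm : dmin ≤ dmax)
    (C C' : ControlRun Tracks dmin dmax dopen dclose)
    (hts : C.trackStatus = C'.trackStatus) :
    (∀ x : Tracks, ∀ t : ℝ, 0 ≤ t → C.deadline x t = C'.deadline x t) ∧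
    (∀ t : ℝ, 0 ≤ t → C.dir t = C'.dir t) := by
  have hts' : ∀ x t, C.trackStatus x t = C'.trackStatus x t := fun x t => by rw [hts]
  have hdl : ∀ x : Tracks, ∀ t : ℝ, 0 ≤ t → C.deadline x t = C'.deadline x t := fun x =>
    eq_of_leftVal_of_rightVal ((C.dl_init x).trans (C'.dl_init x).symm) (C.dl_left x) (C'.dl_left x)
      fun t ht h => ⟨_, C.dlPlus_spec x t ht,
        ControlRun.deadlinePlus_congr ht (hts' x t) h ▸ C'.dlPlus_spec x t ht⟩
  refine ⟨hdl, eq_of_leftVal_of_rightVal (C.dir_init.trans C'.dir_init.symm) C.dir_left C'.dir_left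
    fun t ht h => ⟨_, C.dirPlus_spec t ht, ?_⟩⟩
  rw [ControlRun.dirPlus_congr ht (fun x => hts' x t) (fun x => hdl x t ht) h]
  exact C'.dirPlus_spec t ht

end RailCross
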